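/- Let V = {(12|∅), (13|{4}), (14|{5}), (23|{5}), (35|{1}), (45|{2}), (15|{2,3}), (34|{1,2}), (24|{1,3,5})} ⊆ A_N, where N = {1,2,3,4,5}. Then for every field 𝕂 there is no principally regular symmetric matrix Γ over 𝕂 with rows and columns indexed by N such that CIS(Γ) = V. That is, the gaussoid V is not algebraically realizable over any field. -/

import Mathlib

open scoped symmDiff

abbrev CIStmt (N : Type*) := Sym2 N × Finset N

def CIStmt.proper {N : Type*} (s : CIStmt N) : Prop :=
  ¬ s.1.IsDiag ∧ ∀ i ∈ s.1, i ∉ s.2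

variable {N : Type*} [DecidableEq N]

def pminor {R : Type*} [CommRing R] (M : Matrix N N R) (S : Finset N) : R :=
  (M.submatrix (fun a : S => (a : N)) (fun a : S => (a : N))).det

def apminor {R : Type*} [CommRing R] (M : Matrix N N R) (i j : N) (K : Finset N) : R :=
  (Matrix.of fun a b : Unit ⊕ ↥K =>
      M (Sum.elim (fun _ => i) (fun k => (k : N)) a)
        (Sum.elim (fun _ => j) (fun k => (k : N)) b)).det

def PrinReg {R : Type*} [CommRing R] (M : Matrix N N R) : Prop :=
  ∀ S : Finset N, pminor M S ≠ 0

def PosDefMinors {R : Type*} [Field R] [LinearOrder R] [IsStrictOrderedRing R] (M : Matrix N N R) : Prop :=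
  ∀ S : Finset N, 0 < pminor M S

def CIS {R : Type*} [CommRing R] (M : Matrix N N R) : Set (CIStmt N) :=
  {s | s.proper ∧ ∀ i j : N, s.1 = s(i, j) → apminor M i j s.2 = 0}

def IsGaussoid (G : Set (CIStmt N)) : Prop :=
  (∀ s ∈ G, s.proper) ∧
  ∀ i j k : N, ∀ L : Finset N,
    i ≠ j → i ≠ k → j ≠ k → i ∉ L → j ∉ L → k ∉ L →
      (((s(i,j), L) ∈ G ∧ (s(i,k), insert j L) ∈ G) ↔
        ((s(i,k), L) ∈ G ∧ (s(i,j), insert k L) ∈ G)) ∧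
      (((s(i,j), insert k L) ∈ G ∧ (s(i,k), insert j L) ∈ G) ↔
        ((s(i,j), L) ∈ G ∧ (s(i,k), L) ∈ G)) ∧
      (((s(i,j), L) ∈ G ∧ (s(i,j), insert k L) ∈ G) →
        ((s(i,k), L) ∈ G ∨ (s(j,k), L) ∈ G))


/-- The gaussoid `V` of Example "a non-algebraic gaussoid", on ground set {1,...,5}
modeled by `Fin 5` (`m : Fin 5` stands for `m+1`). -/
def Vgaussoid : Set (CIStmt (Fin 5)) :=
  {(s((0 : Fin 5), 1), (∅ : Finset (Fin 5))),
   (s((0 : Fin 5), 2), ({3} : Finset (Fin 5))),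
   (s((0 : Fin 5), 3), ({4} : Finset (Fin 5))),
   (s((1 : Fin 5), 2), ({4} : Finset (Fin 5))),
   (s((2 : Fin 5), 4), ({0} : Finset (Fin 5))),
   (s((3 : Fin 5), 4), ({1} : Finset (Fin 5))),
   (s((0 : Fin 5), 4), ({1, 2} : Finset (Fin 5))),
   (s((2 : Fin 5), 3), ({0, 1} : Finset (Fin 5))),
   (s((1 : Fin 5), 3), ({0, 2, 4} : Finset (Fin 5)))}

universe u

theorem apminor_eq {R : Type*} [CommRing R] (M : Matrix N N R) (i j : N) (K : Finset N)
    {n : ℕ} (f : Fin n → N) (hf : Function.Injective f) (hK : ∀ x, x ∈ K ↔ ∃ a, f a = x) :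
    apminor M i j K =
      (Matrix.of fun a b : Unit ⊕ Fin n =>
        M (Sum.elim (fun _ => i) f a) (Sum.elim (fun _ => j) f b)).det := by
  let e : Fin n ≃ K := Equiv.ofBijective (fun a => ⟨f a, (hK _).2 ⟨a, rfl⟩⟩)
    ⟨fun a b h => hf (congrArg Subtype.val h), fun x => by
      obtain ⟨a, ha⟩ := (hK x).1 x.2
      exact ⟨a, Subtype.ext ha⟩⟩
  unfold apminor
  rw [← Matrix.det_submatrix_equiv_self ((Equiv.refl Unit).sumCongr e)]
  congr 1
  ext a b
  rcases a with a | a <;> rcases b with b | b <;> rfl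

theorem apminor_eq' {R : Type*} [CommRing R] (M : Matrix N N R) (i j : N) (K : Finset N)
    {n : ℕ} (f : Fin n → N) (hf : Function.Injective f) (hK : ∀ x, x ∈ K ↔ ∃ a, f a = x) :
    apminor M i j K =
      (Matrix.of fun a b : Fin (n + 1) =>
        M ((Fin.cons i f : Fin (n + 1) → N) a) ((Fin.cons j f : Fin (n + 1) → N) b)).det := by
  rw [apminor_eq M i j K f hf hK]
  let g : Unit ⊕ Fin n → Fin (n + 1) := Sum.elim (fun _ => 0) Fin.succ
  let e : Unit ⊕ Fin n ≃ Fin (n + 1) := Equiv.ofBijective g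
    ⟨by
      rintro (a | a) (b | b) h
      · rfl
      · exact absurd h.symm (Fin.succ_ne_zero b)
      · exact absurd h (Fin.succ_ne_zero a)
      · exact congrArg Sum.inr (Fin.succ_injective _ h), fun x => by
      refine Fin.cases ⟨Sum.inl (), rfl⟩ (fun a => ⟨Sum.inr a, rfl⟩) x⟩
  conv_rhs => rw [← Matrix.det_submatrix_equiv_self e]
  congr 1
  ext a b
  rcases a with a | a <;> rcases b with b | b <;> rfl

theorem pminor_eq {R : Type*} [CommRing R] (M : Matrix N N R) (K : Finset N)
    {n : ℕ} (f : Fin n → N) (hf : Function.Injective f) (hK : ∀ x, x ∈ K ↔ ∃ a, f a = x) :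
    pminor M K = (M.submatrix f f).det := by
  let e : Fin n ≃ K := Equiv.ofBijective (fun a => ⟨f a, (hK _).2 ⟨a, rfl⟩⟩)
    ⟨fun a b h => hf (congrArg Subtype.val h), fun x => by
      obtain ⟨a, ha⟩ := (hK x).1 x.2
      exact ⟨a, Subtype.ext ha⟩⟩
  unfold pminor
  rw [← Matrix.det_submatrix_equiv_self e]
  rfl

/-- The algebraic core. -/
theorem core {F : Type*} [Field F]
    (p1 p2 p3 p4 p5 a b c d s13 s14 s23 s35 s45 : F)
    (h1 : p1 ≠ 0) (h2 : p2 ≠ 0) (h3 : p3 ≠ 0) (h4 : p4 ≠ 0) (h5 : p5 ≠ 0)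
    (ha : a ≠ 0) (hb : b ≠ 0) (hc : c ≠ 0) (hd : d ≠ 0)
    (h15 : p1 * p5 - a * a ≠ 0)
    (e1 : s13 * p4 = s14 * d) (e2 : s14 * p5 = a * s45) (e3 : s23 * p5 = c * s35)
    (e4 : s35 * p1 = s13 * a) (e5 : s45 * p2 = b * c)
    (f1 : a * (p2 * p3 - s23 * s23) + s13 * (c * s23 - p2 * s35) = 0)
    (f2 : d * p1 * p2 - s13 * s14 * p2 - s23 * b * p1 = 0)
    (f3 : b * (p1 * (p3 * p5 - s35 * s35) - s13 * (s13 * p5 - s35 * a)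
        + a * (s13 * s35 - p3 * a))
      - s23 * (s14 * (s35 * a - s13 * p5) + d * (p1 * p5 - a * a) + s45 * (s13 * a - p1 * s35))
      - c * (s14 * (s13 * s35 - p3 * a) + d * (s13 * a - p1 * s35)
        + s45 * (p1 * p3 - s13 * s13)) = 0) : False := by
  obtain ⟨A, hA⟩ : ∃ A, A = a ^ 2 / (p1 * p5) := ⟨_, rfl⟩
  obtain ⟨B, hB⟩ : ∃ B, B = b ^ 2 / (p2 * p4) := ⟨_, rfl⟩
  obtain ⟨C, hC⟩ : ∃ C, C = c ^ 2 / (p2 * p5) := ⟨_, rfl⟩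
  obtain ⟨D, hD⟩ : ∃ D, D = d ^ 2 / (p3 * p4) := ⟨_, rfl⟩
  have g45 : s45 = b * c / p2 := by field_simp; linear_combination e5
  have g14 : s14 = a * b * c / (p2 * p5) := by
    rw [g45] at e2; field_simp at e2 ⊢; linear_combination e2
  have g13 : s13 = a * b * c * d / (p2 * p4 * p5) := by
    rw [g14] at e1; field_simp at e1 ⊢; linear_combination e1
  have g35 : s35 = a ^ 2 * b * c * d / (p1 * p2 * p4 * p5) := by
    rw [g13] at e4; field_simp at e4 ⊢; linear_combination e4
  have g23 : s23 = a ^ 2 * b * c ^ 2 * d / (p1 * p2 * p4 * p5 ^ 2) := by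
    rw [g35] at e3; field_simp at e3 ⊢; linear_combination e3
  have E1 : 1 - A ^ 2 * B * C ^ 2 * D + A * B * C * D * (C - 1) = 0 := by
    have : (a * p2 * p3) * (1 - A ^ 2 * B * C ^ 2 * D + A * B * C * D * (C - 1)) = 0 := by
      rw [← f1, g13, g23, g35, hA, hB, hC, hD]; field_simp
    simpa [ha, h2, h3] using this
  have E2 : 1 - 2 * (A * B * C) = 0 := by
    have : (d * p1 * p2) * (1 - 2 * (A * B * C)) = 0 := by
      rw [← f2, g13, g23, g14, hA, hB, hC]; field_simp; ring
    simpa [hd, h1, h2] using this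
  have E3 : (1 - A * B * C * D) * (1 - A) - C * (-A * (1 - A * B * C * D * A)
      + A * D * (1 - A) + (1 - A * B * C * D)) = 0 := by
    have : (b * p1 * p3 * p5) * ((1 - A * B * C * D) * (1 - A) - C * (-A * (1 - A * B * C * D * A)
      + A * D * (1 - A) + (1 - A * B * C * D))) = 0 := by
      rw [← f3, g13, g23, g14, g35, g45, hA, hB, hC, hD]; field_simp; ring
    simpa [hb, h1, h3, h5] using this
  have hA1 : 1 - A ≠ 0 := by
    intro h
    apply h15
    rw [hA] at h
    field_simp at h
    linear_combination h
  have hC0 : C ≠ 0 := by rw [hC]; positivity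
  have E1' : 2 - D - D * C * (A - 1) = 0 := by
    linear_combination 2 * E1 - D * E2 * (1 - C + A * C)
  have E3' : (1 - A) * (2 - D - C * (2 - D + D * A)) = 0 := by
    linear_combination 2 * E3 - D * (1 - A) * E2 + C * D * (1 - A ^ 2) * E2
  have E3'' : 2 - D - C * (2 - D + D * A) = 0 := by simpa [hA1] using E3'
  have : C * 2 = 0 := by linear_combination E1' - E3''
  have t : (2 : F) = 0 := by simpa [hC0] using this
  have : (1 : F) = 0 := by linear_combination E2 + (A * B * C) * t
  exact one_ne_zero this

/-- the gaussoid `V` is not algebraically realizable over any field. -/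
theorem stmt17 :
    ∀ (𝕂 : Type u) [Field 𝕂],
      ¬ ∃ Γ : Matrix (Fin 5) (Fin 5) 𝕂,
          Γ.IsSymm ∧ PrinReg Γ ∧ CIS Γ = Vgaussoid := by
  intro 𝕂 _ ⟨Γ, hs, hp, hV⟩
  have sy : ∀ i j, Γ i j = Γ j i := fun i j => hs.apply j i
  have z : ∀ i j K, (s(i, j), K) ∈ Vgaussoid → apminor Γ i j K = 0 := by
    intro i j K h
    rw [← hV] at h
    exact h.2 i j rfl
  have ape : ∀ i j, apminor Γ i j ∅ = Γ i j := by
    intro i j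
    rw [apminor_eq' Γ i j ∅ (![] : Fin 0 → Fin 5) (by decide) (by decide)]
    simp
  have nz : ∀ i j, i ≠ j → (s(i, j), (∅ : Finset (Fin 5))) ∉ Vgaussoid → Γ i j ≠ 0 := by
    intro i j hij h h0
    apply h
    rw [← hV]
    refine ⟨⟨by simpa using hij, by simp⟩, ?_⟩
    intro k l hkl
    rw [ape]
    rcases Sym2.eq_iff.1 hkl with ⟨rfl, rfl⟩ | ⟨rfl, rfl⟩
    · exact h0
    · rw [sy]; exact h0
  have diag : ∀ i, Γ i i ≠ 0 := by
    intro i h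
    apply hp {i}
    rw [pminor_eq Γ {i} (![i] : Fin 1 → Fin 5) (Function.injective_of_subsingleton _)
      (by intro x; simp [eq_comm])]
    rw [Matrix.det_fin_one]
    exact h
  have z01 := z 0 1 ∅ (by simp [Vgaussoid])
  rw [ape] at z01
  have z023 := z 0 2 {3} (by simp [Vgaussoid])
  have z034 := z 0 3 {4} (by simp [Vgaussoid])
  have z124 := z 1 2 {4} (by simp [Vgaussoid])
  have z240 := z 2 4 {0} (by simp [Vgaussoid])
  have z341 := z 3 4 {1} (by simp [Vgaussoid])
  have z04 := z 0 4 {1, 2} (by simp [Vgaussoid])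
  have z23 := z 2 3 {0, 1} (by simp [Vgaussoid])
  have z13 := z 1 3 {0, 2, 4} (by simp [Vgaussoid])
  rw [apminor_eq' Γ _ _ _ (![3] : Fin 1 → Fin 5) (by decide) (by decide)] at z023
  rw [apminor_eq' Γ _ _ _ (![4] : Fin 1 → Fin 5) (by decide) (by decide)] at z034 z124
  rw [apminor_eq' Γ _ _ _ (![0] : Fin 1 → Fin 5) (by decide) (by decide)] at z240
  rw [apminor_eq' Γ _ _ _ (![1] : Fin 1 → Fin 5) (by decide) (by decide)] at z341
  rw [apminor_eq' Γ _ _ _ (![1, 2] : Fin 2 → Fin 5) (by decide) (by decide)] at z04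
  rw [apminor_eq' Γ _ _ _ (![0, 1] : Fin 2 → Fin 5) (by decide) (by decide)] at z23
  rw [apminor_eq' Γ _ _ _ (![0, 2, 4] : Fin 3 → Fin 5) (by decide) (by decide)] at z13
  have q := hp {0, 4}
  rw [pminor_eq Γ _ (![0, 4] : Fin 2 → Fin 5) (by decide) (by decide), Matrix.det_fin_two] at q
  have q : Γ 0 0 * Γ 4 4 - Γ 0 4 * Γ 0 4 ≠ 0 := by
    intro h
    apply q
    simp [sy 4 0, h]
  have n04 := nz 0 4 (by decide) (by simp [Vgaussoid]; decide)
  have n13 := nz 1 3 (by decide) (by simp [Vgaussoid]; decide)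
  have n14 := nz 1 4 (by decide) (by simp [Vgaussoid])
  have n23 := nz 2 3 (by decide) (by simp [Vgaussoid]; decide)
  simp [Matrix.det_succ_row_zero, Fin.sum_univ_succ, Fin.succAbove, Fin.cons, Fin.cases,
    Fin.induction, Fin.induction.go] at z023 z034 z124 z240 z341 z04 z23 z13
  have z10 : Γ 1 0 = 0 := by rw [sy, z01]
  rw [z10] at z13
  rw [z01, z10] at z23
  rw [z01] at z04
  rw [sy 4 2, sy 4 0, sy 2 0, sy 4 3] at z13
  rw [sy 2 0, sy 2 1] at z23
  rw [sy 2 1] at z04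
  rw [sy 3 2] at z023
  rw [sy 4 3] at z034
  rw [sy 4 2] at z124
  rw [sy 2 0] at z240
  rw [sy 3 1] at z341
  exact core (Γ 0 0) (Γ 1 1) (Γ 2 2) (Γ 3 3) (Γ 4 4) (Γ 0 4) (Γ 1 3) (Γ 1 4) (Γ 2 3)
    (Γ 0 2) (Γ 0 3) (Γ 1 2) (Γ 2 4) (Γ 3 4) (diag 0) (diag 1) (diag 2) (diag 3) (diag 4)
    n04 n13 n14 n23 q
    (by linear_combination z023) (by linear_combination z034) (by linear_combination z124)
    (by linear_combination z240) (by linear_combination z341)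
    (by linear_combination z04) (by linear_combination z23) (by linear_combination z13)
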